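/- There is an absolute constant C > 0 such that the following holds. Let ε ∈ (0,1), let T be a weighted tree with tree metric d_T, and let K ⊆ V(T) be a nonempty set of terminals. Then there exists a non-Steiner tree cover of the finite metric space (K, d_T) of size at most C·ε⁻²·log(2/ε) and stretch 2+ε; that is, a collection of at most C·ε⁻²·log(2/ε) dominating trees T_1,…,T_β on K such that for all x,y ∈ K, min_{1≤i≤β} d_{T_i}(x,y) ≤ (2+ε)·d_T(x,y). -/

import Mathlib

open scoped ENNReal

/-- The total length of a walk with respect to an edge-length function. -/
noncomputable def walkLen {V : Type*} {G : SimpleGraph V} {x y : V}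
    (len : V → V → ℝ≥0∞) (p : G.Walk x y) : ℝ≥0∞ :=
  (p.darts.map (fun d => len d.toProd.1 d.toProd.2)).sum

/-- Walk-distance in a graph with edge lengths: the infimum over walks of the total
length (`∞` if no walk exists). -/
noncomputable def gdist {V : Type*} (G : SimpleGraph V) (len : V → V → ℝ≥0∞)
    (x y : V) : ℝ≥0∞ :=
  ⨅ p : G.Walk x y, walkLen len p

/-- A weighted tree: a connected acyclic simple graph together with positive
(finite) real lengths on its edges. -/
structure WeightedTree (V : Type*) where
  graph : SimpleGraph V
  isTree : graph.IsTree
  len : V → V → ℝ≥0∞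
  len_symm : ∀ x y, len x y = len y x
  len_pos : ∀ ⦃x y⦄, graph.Adj x y → 0 < len x y
  len_ne_top : ∀ ⦃x y⦄, graph.Adj x y → len x y ≠ ⊤

/-- The tree metric of a weighted tree. -/
noncomputable def WeightedTree.dist {V : Type*} (T : WeightedTree V) (x y : V) : ℝ≥0∞ :=
  gdist T.graph T.len x y

/-- A non-Steiner tree cover of `(K, d)` with stretch `α`: a list of dominating
trees on `K` such that each pair has its distance preserved within factor `α`
in at least one of the trees. -/
def IsNonSteinerTreeCover {K : Type*} (d : K → K → ℝ) (α : ℝ)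
    (Ts : List (WeightedTree K)) : Prop :=
  (∀ T ∈ Ts, ∀ x y : K, ENNReal.ofReal (d x y) ≤ T.dist x y) ∧
  (∀ x y : K, ∃ T ∈ Ts, T.dist x y ≤ ENNReal.ofReal (α * d x y))


namespace TC

open SimpleGraph

lemma walkLen_nil {V : Type*} {G : SimpleGraph V} (len : V → V → ℝ≥0∞) (x : V) :
    walkLen len (Walk.nil : G.Walk x x) = 0 := by
  simp [walkLen]

lemma walkLen_cons {V : Type*} {G : SimpleGraph V} (len : V → V → ℝ≥0∞) {x y z : V}
    (h : G.Adj x y) (p : G.Walk y z) :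
    walkLen len (Walk.cons h p) = len x y + walkLen len p := by
  simp [walkLen]

lemma walkLen_append {V : Type*} {G : SimpleGraph V} (len : V → V → ℝ≥0∞) {x y z : V}
    (p : G.Walk x y) (q : G.Walk y z) :
    walkLen len (p.append q) = walkLen len p + walkLen len q := by
  simp [walkLen]

lemma walkLen_reverse {V : Type*} {G : SimpleGraph V} (len : V → V → ℝ≥0∞)
    (hs : ∀ x y, len x y = len y x) {x y : V} (p : G.Walk x y) :
    walkLen len p.reverse = walkLen len p := by
  induction p with
  | nil => rfl
  | cons h p ih =>
    rw [Walk.reverse_cons, walkLen_append, walkLen_cons, walkLen_cons, walkLen_nil, ih, hs]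
    ring

lemma walkLen_bypass_le {V : Type*} [DecidableEq V] {G : SimpleGraph V} (len : V → V → ℝ≥0∞)
    {x y : V} (p : G.Walk x y) : walkLen len p.bypass ≤ walkLen len p := by
  unfold walkLen
  exact ((Walk.darts_bypass_sublist_darts p).map _).sum_le_sum (by simp)

section Tree
variable {V : Type*} (T : WeightedTree V)

lemma dist_self (x : V) : T.dist x x = 0 := by
  apply le_antisymm _ bot_le
  exact (iInf_le _ (Walk.nil : T.graph.Walk x x)).trans (walkLen_nil _ _).le

lemma dist_le_walk {x y : V} (p : T.graph.Walk x y) : T.dist x y ≤ walkLen T.len p :=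
  iInf_le _ p

lemma dist_path {x y : V} (p : T.graph.Walk x y) (hp : p.IsPath) :
    T.dist x y = walkLen T.len p := by
  classical
  apply le_antisymm (dist_le_walk T p)
  refine le_iInf fun q => ?_
  have : q.bypass = p :=
    (T.isTree.existsUnique_path x y).unique (Walk.bypass_isPath q) hp
  rw [← this]
  exact walkLen_bypass_le _ _

lemma dist_adj_le {x y : V} (h : T.graph.Adj x y) : T.dist x y ≤ T.len x y := by
  refine (dist_le_walk T (Walk.cons h Walk.nil)).trans ?_
  rw [walkLen_cons, walkLen_nil, add_zero]

lemma exists_path (x y : V) : ∃ p : T.graph.Walk x y, p.IsPath :=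
  (T.isTree.existsUnique_path x y).exists

lemma dist_comm (x y : V) : T.dist x y = T.dist y x := by
  obtain ⟨p, hp⟩ := exists_path T x y
  rw [dist_path T p hp, dist_path T p.reverse hp.reverse, walkLen_reverse _ T.len_symm]

lemma dist_triangle (x y z : V) : T.dist x z ≤ T.dist x y + T.dist y z := by
  obtain ⟨p, hp⟩ := exists_path T x y
  obtain ⟨q, hq⟩ := exists_path T y z
  rw [dist_path T p hp, dist_path T q hq, ← walkLen_append]
  exact dist_le_walk T _

lemma walkLen_ne_top {x y : V} (p : T.graph.Walk x y) : walkLen T.len p ≠ ⊤ := by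
  induction p with
  | nil => simp [walkLen_nil]
  | cons h p ih =>
    rw [walkLen_cons]
    exact ENNReal.add_ne_top.2 ⟨T.len_ne_top h, ih⟩

lemma dist_ne_top (x y : V) : T.dist x y ≠ ⊤ := by
  obtain ⟨p, hp⟩ := exists_path T x y
  rw [dist_path T p hp]
  exact walkLen_ne_top T p

lemma dist_pos {x y : V} (h : x ≠ y) : 0 < T.dist x y := by
  obtain ⟨p, hp⟩ := exists_path T x y
  rw [dist_path T p hp]
  cases p with
  | nil => exact absurd rfl h
  | cons h p =>
    rw [walkLen_cons]
    exact lt_of_lt_of_le (T.len_pos h) le_self_add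

/-- real-valued distance -/
noncomputable def rd (x y : V) : ℝ := (T.dist x y).toReal

lemma rd_self (x : V) : rd T x x = 0 := by simp [rd, dist_self]
lemma rd_comm (x y : V) : rd T x y = rd T y x := by simp [rd, dist_comm T x y]
lemma rd_pos {x y : V} (h : x ≠ y) : 0 < rd T x y :=
  ENNReal.toReal_pos (dist_pos T h).ne' (dist_ne_top T _ _)
lemma rd_triangle (x y z : V) : rd T x z ≤ rd T x y + rd T y z := by
  unfold rd
  rw [← ENNReal.toReal_add (dist_ne_top T _ _) (dist_ne_top T _ _)]
  exact ENNReal.toReal_mono (ENNReal.add_ne_top.2 ⟨dist_ne_top T _ _, dist_ne_top T _ _⟩)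
    (dist_triangle T x y z)

lemma rd_append {x y z : V} (p : T.graph.Walk x y) (q : T.graph.Walk y z)
    (h : (p.append q).IsPath) : rd T x z = rd T x y + rd T y z := by
  unfold rd
  rw [← ENNReal.toReal_add (dist_ne_top T _ _) (dist_ne_top T _ _),
    dist_path T _ h, dist_path T p h.of_append_left, dist_path T q h.of_append_right,
    walkLen_append]

lemma rd_between {x z m : V} (p : T.graph.Walk x z) (hp : p.IsPath) (hm : m ∈ p.support) :
    rd T x z = rd T x m + rd T m z := by
  classical
  apply rd_append T (p.takeUntil m hm) (p.dropUntil m hm)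
  rwa [Walk.take_spec]

lemma rd_order {x z m n : V} (p : T.graph.Walk x z) (hp : p.IsPath) (hm : m ∈ p.support)
    (hn : n ∈ p.support) : rd T m n = |rd T x m - rd T x n| := by
  classical
  have h1 := rd_between T p hp hm
  have h2 := rd_between T p hp hn
  have h3 := hn
  rw [← Walk.take_spec p hm, Walk.mem_support_append_iff] at h3
  have h0 := rd_comm T m n
  have hnn : 0 ≤ rd T m n := ENNReal.toReal_nonneg
  rcases h3 with h3 | h3
  · have := rd_between T _ (hp.takeUntil hm) h3
    rw [abs_of_nonneg] <;> linarith
  · have := rd_between T _ (hp.dropUntil hm) h3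
    rw [abs_of_nonpos] <;> linarith

lemma isPath_append {G : SimpleGraph V} {w m x : V} (q : G.Walk w m) (r : G.Walk m x)
    (hq : q.IsPath) (hr : r.IsPath) (h : ∀ v ∈ q.support, v ∈ r.support → v = m) :
    (q.append r).IsPath := by
  rw [Walk.isPath_def, Walk.support_append, List.nodup_append']
  have hr' := (Walk.isPath_def _).1 hr
  have e : r.support = m :: r.support.tail := (Walk.cons_tail_support r).symm
  rw [e, List.nodup_cons] at hr'
  refine ⟨(Walk.isPath_def _).1 hq, hr'.2, ?_⟩
  intro v hv hv'
  have := h v hv (List.mem_of_mem_tail hv')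
  subst this
  exact hr'.1 hv'

lemma gate_aux {G : SimpleGraph V} (S : Set V) {w x : V} (p : G.Walk w x) (hx : x ∈ S) :
    ∃ m ∈ S, ∃ q : G.Walk w m, q.IsPath ∧ ∀ v ∈ q.support, v ∈ S → v = m := by
  classical
  induction p with
  | nil => exact ⟨_, hx, Walk.nil, Walk.IsPath.nil, by simp⟩
  | @cons a b c h p ih =>
    by_cases ha : a ∈ S
    · exact ⟨a, ha, Walk.nil, Walk.IsPath.nil, by simp⟩
    · obtain ⟨m, hm, q, hq, hq'⟩ := ih hx
      refine ⟨m, hm, (Walk.cons h q).bypass, Walk.bypass_isPath _, fun v hv hvS => ?_⟩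
      have := Walk.support_bypass_subset_support _ hv
      rw [Walk.support_cons, List.mem_cons] at this
      rcases this with rfl | h
      · exact absurd hvS ha
      · exact hq' v h hvS

lemma gate {x z : V} (p : T.graph.Walk x z) (hp : p.IsPath) (w : V) :
    ∃ m ∈ p.support, rd T w x = rd T w m + rd T m x ∧ rd T w z = rd T w m + rd T m z := by
  classical
  obtain ⟨q0, -⟩ := exists_path T w x
  obtain ⟨m, hm, q, hq, hq'⟩ := gate_aux {v | v ∈ p.support} q0 (by simp)
  refine ⟨m, hm, ?_, ?_⟩
  · apply rd_append T q (p.takeUntil m hm).reverse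
    apply isPath_append _ _ hq (hp.takeUntil hm).reverse
    intro v hv hv'
    rw [Walk.support_reverse, List.mem_reverse] at hv'
    exact hq' v hv (Walk.support_takeUntil_subset_support _ _ hv')
  · apply rd_append T q (p.dropUntil m hm)
    apply isPath_append _ _ hq (hp.dropUntil hm)
    intro v hv hv'
    exact hq' v hv (Walk.support_dropUntil_subset_support _ _ hv')

lemma four_point (x y z w : V) :
    rd T x z + rd T w y ≤ max (rd T x y + rd T w z) (rd T y z + rd T w x) := by
  obtain ⟨p, hp⟩ := exists_path T x z
  obtain ⟨a, ha, a1, a2⟩ := gate T p hp w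
  obtain ⟨b, hb, b1, b2⟩ := gate T p hp y
  have h1 := rd_between T p hp ha
  have h2 := rd_between T p hp hb
  have h3 := rd_order T p hp ha hb
  have t1 := rd_triangle T w a y
  have t2 := rd_triangle T a b y
  rw [rd_comm T b y] at t2
  rw [rd_comm T a x] at a1
  rw [rd_comm T b x] at b1
  rw [rd_comm T y x] at b1
  rw [le_max_iff]
  rcases abs_cases (rd T x a - rd T x b) with ⟨h, _⟩ | ⟨h, _⟩
  · right; linarith
  · left; linarith

end Tree

/-- Parent-pointer graphs are trees. -/
lemma parent_isTree {K : Type*} [Finite K] (ρ : K) (par : K → K) (rank : K → ℕ)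
    (hr : ∀ v, v ≠ ρ → rank (par v) < rank v) (G : SimpleGraph K)
    (hG : ∀ u v, G.Adj u v ↔ (u ≠ ρ ∧ par u = v) ∨ (v ≠ ρ ∧ par v = u)) : G.IsTree := by
  classical
  have := Fintype.ofFinite K
  have hconn : ∀ n v, rank v ≤ n → G.Reachable v ρ := by
    intro n
    induction n with
    | zero =>
      intro v hv
      by_cases h : v = ρ
      · rw [h]
      · have := hr v h; omega
    | succ n ih =>
      intro v hv
      by_cases h : v = ρ
      · rw [h]
      · have h1 := hr v h
        have h2 : G.Adj v (par v) := (hG _ _).2 (Or.inl ⟨h, rfl⟩)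
        exact h2.reachable.trans (ih _ (by omega))
  have hc : G.Connected := by
    have : Nonempty K := ⟨ρ⟩
    refine ⟨fun u v => (hconn _ u le_rfl).trans (hconn _ v le_rfl).symm⟩
  refine isTree_iff_connected_and_card.2 ⟨hc, le_antisymm ?_ ?_⟩
  · have hsub : G.edgeSet ⊆ ((Finset.univ.erase ρ).image (fun v => s(v, par v)) : Finset (Sym2 K)) := by
      intro e
      induction e with
      | _ u v =>
      intro he
      rw [mem_edgeSet, hG] at he
      simp only [Finset.coe_image, Set.mem_image, Finset.mem_coe, Finset.mem_erase, Finset.mem_univ,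
        and_true]
      rcases he with ⟨h, rfl⟩ | ⟨h, rfl⟩
      · exact ⟨u, h, rfl⟩
      · exact ⟨v, h, Sym2.eq_swap⟩
    have h1 := Set.ncard_le_ncard hsub (Finset.finite_toSet _)
    rw [Set.ncard_coe_finset] at h1
    have h2 := (Finset.card_image_le (s := Finset.univ.erase ρ) (f := fun v => s(v, par v)))
    rw [Finset.card_erase_of_mem (Finset.mem_univ _), Finset.card_univ] at h2
    have h3 : 0 < Fintype.card K := Fintype.card_pos_iff.2 ⟨ρ⟩
    rw [Nat.card_coe_set_eq, Nat.card_eq_fintype_card]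
    omega
  · exact hc.card_vert_le_card_edgeSet_add_one

/-- A hierarchy of partitions gives a dominating tree. -/
lemma hier_tree {K : Type*} [Finite K] [Nonempty K] (d : K → K → ℝ)
    (hself : ∀ x, d x x = 0) (hcomm : ∀ x y, d x y = d y x) (hpos : ∀ x y, x ≠ y → 0 < d x y)
    (htri : ∀ x y z, d x z ≤ d x y + d y z) (dep : K → ℝ) (E : ℕ → K → K → Prop)
    (hE : ∀ k, Equivalence (E k)) (h0 : ∀ x y, E 0 x y → x = y)
    (hmono : ∀ k x y, E k x y → E (k + 1) x y) (hN : ∃ N, ∀ x y, E N x y) :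
    ∃ (T : WeightedTree K) (r : ℕ → K → K), (∀ x y, ENNReal.ofReal (d x y) ≤ T.dist x y) ∧
      (∀ x, r 0 x = x) ∧ (∀ k x, E k x (r k x)) ∧ (∀ k x y, E k x y → r k x = r k y) ∧
      (∀ k x, T.dist (r k x) (r (k + 1) x) ≤ ENNReal.ofReal (d (r k x) (r (k + 1) x))) ∧
      (∀ k x y, E (k + 1) x y → ∃ m, dep m ≤ dep y ∧ E k m (r (k + 1) x)) := by
  classical
  obtain ⟨N, hN⟩ := hN
  have hmn : ∀ S : Set K, ∃ m, S.Nonempty → (m ∈ S ∧ ∀ y ∈ S, dep m ≤ dep y) := by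
    intro S
    by_cases hS : S.Nonempty
    · obtain ⟨m, hm, hm'⟩ := Set.exists_min_image S dep S.toFinite hS
      exact ⟨m, fun _ => ⟨hm, hm'⟩⟩
    · exact ⟨Classical.arbitrary K, fun h => absurd h hS⟩
  choose mn hmn using hmn
  obtain ⟨r, r0, rs⟩ : ∃ r : ℕ → K → K, (∀ x, r 0 x = x) ∧
      ∀ k x, r (k + 1) x = r k (mn {y | E (k + 1) x y}) :=
    ⟨fun k => Nat.rec (fun x => x) (fun k rk x => rk (mn {y | E (k + 1) x y})) k,
      fun x => rfl, fun k x => rfl⟩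
  have hm : ∀ k x, E k x (mn {y | E k x y}) ∧ ∀ y, E k x y → dep (mn {y | E k x y}) ≤ dep y :=
    fun k x => hmn {y | E k x y} ⟨x, (hE k).refl x⟩
  have ra : ∀ k x, E k x (r k x) := by
    intro k
    induction k with
    | zero => intro x; rw [r0]; exact (hE 0).refl x
    | succ k ih =>
      intro x
      rw [rs]
      exact (hE _).trans (hm (k + 1) x).1 (hmono _ _ _ (ih _))
  have rb : ∀ k x y, E k x y → r k x = r k y := by
    intro k x y h
    cases k with
    | zero => rw [h0 _ _ h]
    | succ k =>
      rw [rs, rs]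
      congr 2
      ext z
      exact ⟨fun h' => (hE _).trans ((hE _).symm h) h', fun h' => (hE _).trans h h'⟩
  have ridem : ∀ k x, r k (r k x) = r k x := fun k x => (rb k _ _ (ra k x)).symm
  have rfix1 : ∀ k v, r (k + 1) v = v → r k v = v := by
    intro k v h
    rw [rs] at h
    rw [← h, ridem]
  have rfix : ∀ j k v, j ≤ k → r k v = v → r j v = v := by
    intro j k v hjk
    induction hjk with
    | refl => exact id
    | step _ ih => exact fun h => ih (rfix1 _ _ h)
  obtain ⟨ρ, hρdef⟩ : ∃ ρ, r N (Classical.arbitrary K) = ρ := ⟨_, rfl⟩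
  have hρN : ∀ j x, r (N + j) x = ρ := by
    intro j
    induction j with
    | zero => intro x; rw [← hρdef]; exact rb N _ _ (hN _ _)
    | succ j ih => intro x; rw [← add_assoc, rs]; exact ih _
  have hρ : ∀ j, r j ρ = ρ := fun j => rfix j (N + j) ρ (by omega) (hρN j ρ)
  have hf : ∀ v, ∃ f : ℕ, v ≠ ρ → r f v ≠ v ∧ f ≤ N ∧ ∀ j < f, r j v = v := by
    intro v
    by_cases hv : v = ρ
    · exact ⟨0, fun h => absurd hv h⟩
    · have hex : ∃ k, r k v ≠ v := ⟨N, by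
        have := hρN 0 v
        rw [add_zero] at this
        rw [this]; exact fun h => hv h.symm⟩
      refine ⟨Nat.find hex, fun _ => ⟨Nat.find_spec hex, ?_, ?_⟩⟩
      · apply Nat.find_min' hex
        have := hρN 0 v
        rw [add_zero] at this
        rw [this]; exact fun h => hv h.symm
      · intro j hj
        exact not_not.1 (Nat.find_min hex hj)
  choose f hf using hf
  let par : K → K := fun v => r (f v) v
  let rank : K → ℕ := fun v => if v = ρ then 0 else N + 1 - f v
  have hrank : ∀ v, v ≠ ρ → rank (par v) < rank v := by
    intro v hv
    obtain ⟨h1, h2, h3⟩ := hf v hv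
    by_cases hp : par v = ρ
    · simp only [rank, hp, hv, if_true, if_false]; omega
    · obtain ⟨g1, g2, g3⟩ := hf _ hp
      simp only [rank, hp, hv, if_false]
      have : f v < f (par v) := by
        by_contra hcon
        exact g1 (rfix _ (f v) _ (by omega) (ridem _ _))
      omega
  let G : SimpleGraph K := SimpleGraph.fromRel (fun u v => u ≠ ρ ∧ par u = v)
  have hG : ∀ u v, G.Adj u v ↔ (u ≠ ρ ∧ par u = v) ∨ (v ≠ ρ ∧ par v = u) := by
    intro u v
    rw [SimpleGraph.fromRel_adj]
    refine ⟨fun h => h.2, fun h => ⟨?_, h⟩⟩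
    rintro rfl
    rcases h with h | h <;> exact (hf u h.1).1 h.2
  let T : WeightedTree K :=
    { graph := G
      isTree := parent_isTree ρ par rank hrank G hG
      len := fun x y => ENNReal.ofReal (d x y)
      len_symm := fun x y => by rw [hcomm]
      len_pos := fun x y h => ENNReal.ofReal_pos.2 (hpos x y h.ne)
      len_ne_top := fun x y h => ENNReal.ofReal_ne_top }
  refine ⟨T, r, ?_, r0, ra, rb, ?_, ?_⟩
  · intro x y
    refine le_iInf fun p => ?_
    induction p with
    | nil => simp [hself]
    | @cons a b c h p ih =>
      rw [walkLen_cons]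
      calc ENNReal.ofReal (d a c) ≤ ENNReal.ofReal (d a b + d b c) :=
            ENNReal.ofReal_le_ofReal (htri _ _ _)
        _ ≤ ENNReal.ofReal (d a b) + ENNReal.ofReal (d b c) := ENNReal.ofReal_add_le
        _ ≤ _ := add_le_add le_rfl ih
  · intro k x
    have e : r (k + 1) x = r (k + 1) (r k x) := rb _ _ _ (hmono _ _ _ (ra k x))
    rw [e]
    have hv := ridem k x
    generalize r k x = v at hv
    by_cases h : r (k + 1) v = v
    · rw [h, dist_self]; exact bot_le
    · have hvρ : v ≠ ρ := by
        rintro rfl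
        exact h (hρ _)
      obtain ⟨g1, g2, g3⟩ := hf v hvρ
      have hfv : f v = k + 1 := by
        apply le_antisymm
        · by_contra hcon
          exact h (g3 _ (by omega))
        · by_contra hcon
          exact g1 (rfix _ k _ (by omega) hv)
      have : T.graph.Adj v (r (k + 1) v) := (hG _ _).2 (Or.inl ⟨hvρ, by rw [← hfv]⟩)
      exact dist_adj_le T this
  · intro k x y h
    refine ⟨mn {y | E (k + 1) x y}, (hm _ x).2 y h, ?_⟩
    rw [rs]
    exact ra _ _

/-- normalized shifted height at level `k` -/
noncomputable def uu (D0 : ℝ) (R s : ℕ) : ℕ → ℝ → ℝ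
  | 0, h => h / D0
  | k + 1, h => (uu D0 R s k h + s) / R

lemma uu_sub (D0 : ℝ) (hD : 0 < D0) (R s : ℕ) (hR : 0 < R) (k : ℕ) (a b : ℝ) :
    (uu D0 R s k a - uu D0 R s k b) * (D0 * R ^ k) = a - b := by
  have hR' : (0 : ℝ) < R := by exact_mod_cast hR
  induction k with
  | zero => simp only [uu]; field_simp; try simp
  | succ k ih =>
    simp only [uu]
    rw [← ih]
    field_simp
    ring

lemma uu_mono (D0 : ℝ) (hD : 0 < D0) (R s : ℕ) (k : ℕ) {a b : ℝ} (h : a ≤ b) :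
    uu D0 R s k a ≤ uu D0 R s k b := by
  induction k with
  | zero => simp only [uu]; gcongr
  | succ k ih => simp only [uu]; gcongr

lemma uu_floor (D0 : ℝ) (R s : ℕ) (k : ℕ) (a : ℝ) :
    ⌊uu D0 R s (k + 1) a⌋ = (⌊uu D0 R s k a⌋ + s) / (R : ℤ) := by
  simp only [uu]
  rw [Int.floor_div_natCast, Int.floor_add_natCast]

lemma uu_zero (D0 : ℝ) (R s : ℕ) (hs : s + 2 ≤ R) (k : ℕ) :
    0 ≤ uu D0 R s k 0 ∧ uu D0 R s k 0 ≤ 1 - 1 / R := by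
  have hs' : (s : ℝ) + 2 ≤ R := by exact_mod_cast hs
  have hs0 : (0 : ℝ) ≤ s := by positivity
  have hR : (0 : ℝ) < R := by linarith
  have hR1 : 1 / (R : ℝ) ≤ 1 := by rw [div_le_one hR]; linarith
  have hR0 : 0 < 1 / (R : ℝ) := by positivity
  induction k with
  | zero => simp only [uu, zero_div]; constructor <;> linarith
  | succ k ih =>
    simp only [uu]
    refine ⟨by have := ih.1; positivity, ?_⟩
    rw [div_le_iff₀ hR]
    have : (1 - 1 / (R : ℝ)) * R = R - 1 := by field_simp
    rw [this]
    linarith [ih.2]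

lemma choose_shift (R : ℕ) (hR : 4 ≤ R) (D0 : ℝ) (hD : 0 < D0) (k : ℕ) (h : ℝ) :
    ∃ s : ℕ, s + 2 ≤ R ∧ ∃ m : ℤ, (m : ℝ) ≤ uu D0 R s (k + 1) h ∧
      uu D0 R s (k + 1) h < m + 3 / R := by
  have hR' : (0 : ℝ) < R := by exact_mod_cast (by omega : 0 < R)
  have key : ∀ s : ℕ, s + 2 ≤ R → ∃ c : ℝ, 0 ≤ c ∧ c < 1 ∧
      uu D0 R s (k + 1) h = (h / (D0 * R ^ k) + c + s) / R := by
    intro s hs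
    obtain ⟨h1, h2⟩ := uu_zero D0 R s hs k
    refine ⟨uu D0 R s k 0, h1, ?_, ?_⟩
    · have : 0 < 1 / (R : ℝ) := by positivity
      linarith
    · simp only [uu]
      have h3 := uu_sub D0 hD R s (by omega) k h 0
      rw [sub_zero] at h3
      have h4 : (0 : ℝ) < D0 * R ^ k := by positivity
      congr 2
      have h5 : h / (D0 * R ^ k) = uu D0 R s k h - uu D0 R s k 0 := by
        rw [div_eq_iff h4.ne']; exact h3.symm
      linarith
  set w := h / (D0 * R ^ k)
  set a := ⌊w⌋
  have ha1 : (a : ℝ) ≤ w := Int.floor_le w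
  have ha2 : w < a + 1 := Int.lt_floor_add_one w
  have hRz : (0 : ℤ) < R := by omega
  have e1 := Int.emod_nonneg (-a) hRz.ne'
  have e2 := Int.emod_lt_of_pos (-a) hRz
  have e3 := Int.emod_add_mul_ediv (-a) R
  set q := (-a) / (R : ℤ)
  obtain ⟨s0, hs0⟩ := Int.eq_ofNat_of_zero_le e1
  rw [hs0] at e2 e3
  have e3' : (a : ℝ) + s0 = R * (-q) := by
    have : a + s0 = R * (-q) := by linarith
    exact_mod_cast this
  by_cases hcase : s0 + 2 ≤ R
  · obtain ⟨c, c0, c1, hc⟩ := key s0 hcase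
    refine ⟨s0, hcase, -q, ?_, ?_⟩
    · rw [hc, le_div_iff₀ hR']; push_cast; linarith
    · rw [hc, div_lt_iff₀ hR', add_mul, div_mul_cancel₀ _ hR'.ne']; push_cast; linarith
  · have hs : s0 + 1 = R := by omega
    have hs' : (s0 : ℝ) + 1 = R := by exact_mod_cast hs
    obtain ⟨c, c0, c1, hc⟩ := key 0 (by omega)
    refine ⟨0, by omega, -q - 1, ?_, ?_⟩
    · rw [hc, le_div_iff₀ hR']; push_cast; linarith
    · rw [hc, div_lt_iff₀ hR', add_mul, div_mul_cancel₀ _ hR'.ne']; push_cast; linarith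

lemma shift_tree {K : Type*} [Finite K] [Nonempty K] (d : K → K → ℝ)
    (hself : ∀ x, d x x = 0) (hcomm : ∀ x y, d x y = d y x) (hpos : ∀ x y, x ≠ y → 0 < d x y)
    (htri : ∀ x y z, d x z ≤ d x y + d y z) (dep : K → ℝ) (g : K → K → ℝ)
    (hg : ∀ x y, d x y = dep x + dep y - 2 * g x y) (hg0 : ∀ x y, 0 ≤ g x y)
    (hdep : ∀ x y, dep x ≤ dep y + d x y)
    (hyp : ∀ x y z, min (g x y) (g y z) ≤ g x z)
    (D0 : ℝ) (hD : 0 < D0) (hD' : ∀ x y, x ≠ y → 2 * D0 ≤ d x y)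
    (R s : ℕ) (hR : 4 ≤ R) (hs : s + 2 ≤ R) :
    ∃ T : WeightedTree K, (∀ x y, ENNReal.ofReal (d x y) ≤ T.dist x y) ∧
      ∀ x y k (m : ℤ), 4 * d x y ≤ D0 * R ^ (k + 1) → (m : ℝ) ≤ uu D0 R s (k + 1) (g x y) →
        uu D0 R s (k + 1) (g x y) < m + 3 / R →
        T.dist x y ≤ ENNReal.ofReal (2 * d x y + 26 * (D0 * R ^ k)) := by
  classical
  have hR0 : 0 < R := by omega
  have hR' : (4 : ℝ) ≤ R := by exact_mod_cast hR
  have hRpos : (0 : ℝ) < R := by linarith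
  have hΔ : ∀ k : ℕ, 0 < D0 * (R : ℝ) ^ k := fun k => by positivity
  have hgx : ∀ x, g x x = dep x := fun x => by have := hg x x; rw [hself] at this; linarith
  have hgc : ∀ x y, g x y = g y x := fun x y => by
    have := hg x y; have := hg y x; have := hcomm x y; linarith
  have hgle : ∀ x y, g x y ≤ dep x := fun x y => by
    have := hg x y; have := hdep y x; have := hcomm x y; linarith
  have hgd : ∀ x y, dep x ≤ g x y + d x y := fun x y => by
    have := hg x y; have := hdep x y; linarith
  have hdp : ∀ x, 0 ≤ dep x := fun x => by rw [← hgx]; exact hg0 x x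
  obtain ⟨u, hu⟩ : ∃ u, u = uu D0 R s := ⟨_, rfl⟩
  rw [← hu]
  have usub : ∀ k a b, (u k a - u k b) * (D0 * R ^ k) = a - b := by
    rw [hu]; exact uu_sub D0 hD R s hR0
  have umono : ∀ k a b, a ≤ b → u k a ≤ u k b := by
    rw [hu]; exact fun k a b h => uu_mono D0 hD R s k h
  have ufl : ∀ k a, ⌊u (k + 1) a⌋ = (⌊u k a⌋ + s) / (R : ℤ) := by
    rw [hu]; exact uu_floor D0 R s
  have u00 : ∀ k, 0 ≤ u k 0 ∧ u k 0 ≤ 1 - 1 / R := by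
    rw [hu]; exact uu_zero D0 R s hs
  let E : ℕ → K → K → Prop := fun k x y =>
    ⌊u k (dep x)⌋ = ⌊u k (dep y)⌋ ∧ ⌊u k (dep x)⌋ ≤ ⌊u k (g x y)⌋
  have hE : ∀ k, Equivalence (E k) := by
    intro k
    refine ⟨fun x => ⟨rfl, by rw [hgx]⟩, ?_, ?_⟩
    · rintro x y ⟨h1, h2⟩
      exact ⟨h1.symm, by rw [← h1, hgc y x]; exact h2⟩
    · rintro x y z ⟨h1, h2⟩ ⟨h3, h4⟩
      refine ⟨h1.trans h3, ?_⟩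
      rcases min_le_iff.1 (hyp x y z) with h | h
      · exact h2.trans (Int.floor_le_floor (umono k _ _ h))
      · rw [h1]; exact h4.trans (Int.floor_le_floor (umono k _ _ h))
  have hdiam : ∀ k x y, E k x y → d x y < 2 * (D0 * R ^ k) := by
    rintro k x y ⟨h1, h2⟩
    have a1 := Int.lt_floor_add_one (u k (dep x))
    have a2 := Int.lt_floor_add_one (u k (dep y))
    have a3 := Int.floor_le (u k (g x y))
    have a4 : (⌊u k (dep x)⌋ : ℝ) ≤ ⌊u k (g x y)⌋ := by exact_mod_cast h2
    rw [← h1] at a2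
    have b1 := usub k (dep x) (g x y)
    have b2 := usub k (dep y) (g x y)
    have c1 : (u k (dep x) - u k (g x y)) * (D0 * R ^ k) < 1 * (D0 * R ^ k) :=
      mul_lt_mul_of_pos_right (by linarith) (hΔ k)
    have c2 : (u k (dep y) - u k (g x y)) * (D0 * R ^ k) < 1 * (D0 * R ^ k) :=
      mul_lt_mul_of_pos_right (by linarith) (hΔ k)
    have := hg x y
    linarith
  have hdepd : ∀ k x y, E k x y → dep x ≤ dep y + D0 * R ^ k := by
    rintro k x y ⟨h1, h2⟩
    have a1 := Int.lt_floor_add_one (u k (dep x))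
    have a2 := Int.floor_le (u k (dep y))
    rw [← h1] at a2
    have b1 := usub k (dep x) (dep y)
    have c1 : (u k (dep x) - u k (dep y)) * (D0 * R ^ k) < 1 * (D0 * R ^ k) :=
      mul_lt_mul_of_pos_right (by linarith) (hΔ k)
    linarith
  have hE0 : ∀ x y, E 0 x y → x = y := by
    intro x y h
    by_contra hne
    have h1 := hdiam 0 x y h
    have h2 := hD' x y hne
    rw [pow_zero] at h1
    linarith
  have hmono : ∀ k x y, E k x y → E (k + 1) x y := by
    rintro k x y ⟨h1, h2⟩
    refine ⟨by rw [ufl, ufl, h1], ?_⟩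
    rw [ufl, ufl]
    exact Int.ediv_le_ediv (by omega) (by omega)
  have hN : ∃ N, ∀ x y, E N x y := by
    obtain ⟨H, hH⟩ := (Set.finite_range dep).bddAbove
    have hH' : ∀ x, dep x ≤ H := fun x => hH ⟨x, rfl⟩
    obtain ⟨N, hN⟩ := pow_unbounded_of_one_lt (R * H / D0) (by linarith : (1 : ℝ) < R)
    have hz : ∀ a, 0 ≤ a → a ≤ H → ⌊u N a⌋ = 0 := by
      intro a ha haH
      rw [Int.floor_eq_zero_iff]
      refine ⟨(u00 N).1.trans (umono N _ _ ha), ?_⟩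
      have h1 := usub N a 0
      rw [div_lt_iff₀ hD] at hN
      have h2 : u N a - u N 0 < 1 / R := by
        rw [lt_div_iff₀ hRpos]
        by_contra hcon
        push Not at hcon
        have h3 : 1 * (D0 * (R : ℝ) ^ N) ≤ (u N a - u N 0) * R * (D0 * R ^ N) :=
          mul_le_mul_of_nonneg_right hcon (hΔ N).le
        have h4 : (u N a - u N 0) * R * (D0 * R ^ N) = R * a := by
          rw [mul_right_comm, h1]; ring
        have h5 : (R : ℝ) * a ≤ R * H := by gcongr
        linarith
      linarith [(u00 N).2]
    refine ⟨N, fun x y => ⟨?_, ?_⟩⟩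
    · rw [hz _ (hdp x) (hH' x), hz _ (hdp y) (hH' y)]
    · rw [hz _ (hdp x) (hH' x), hz _ (hg0 x y) ((hgle x y).trans (hH' x))]
  obtain ⟨T, r, hdom, r0, ra, rb, redge, rmin⟩ :=
    hier_tree d hself hcomm hpos htri dep E hE hE0 hmono hN
  have hdn : ∀ x y, 0 ≤ d x y := fun x y => by
    by_cases h : x = y
    · rw [h, hself]
    · exact (hpos x y h).le
  have hup : ∀ k x, T.dist x (r k x) ≤ ENNReal.ofReal (4 * (D0 * R ^ k)) := by
    intro k x
    induction k with
    | zero => rw [r0, dist_self]; exact bot_le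
    | succ k ih =>
      have h1 : d (r k x) (r (k + 1) x) < 2 * (D0 * R ^ (k + 1)) :=
        hdiam (k + 1) _ _ ((hE _).trans ((hE _).symm (hmono _ _ _ (ra k x))) (ra (k + 1) x))
      have h2 : 4 * (D0 * (R : ℝ) ^ k) ≤ 2 * (D0 * R ^ (k + 1)) := by
        have := hΔ k
        rw [pow_succ]
        nlinarith
      calc T.dist x (r (k + 1) x) ≤ T.dist x (r k x) + T.dist (r k x) (r (k + 1) x) :=
            dist_triangle T _ _ _
        _ ≤ ENNReal.ofReal (4 * (D0 * R ^ k)) + ENNReal.ofReal (d (r k x) (r (k + 1) x)) :=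
            add_le_add ih (redge k x)
        _ = ENNReal.ofReal (4 * (D0 * R ^ k) + d (r k x) (r (k + 1) x)) :=
            (ENNReal.ofReal_add (by have := hΔ k; positivity) (hdn _ _)).symm
        _ ≤ _ := ENNReal.ofReal_le_ofReal (by linarith)
  have hup2 : ∀ k x, T.dist x (r (k + 1) x) ≤
      ENNReal.ofReal (6 * (D0 * R ^ k) + d x (r (k + 1) x)) := by
    intro k x
    have h1 := hdiam k _ _ ((hE k).symm (ra k x))
    have h2 := htri (r k x) x (r (k + 1) x)
    calc T.dist x (r (k + 1) x) ≤ T.dist x (r k x) + T.dist (r k x) (r (k + 1) x) :=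
          dist_triangle T _ _ _
      _ ≤ ENNReal.ofReal (4 * (D0 * R ^ k)) + ENNReal.ofReal (d (r k x) (r (k + 1) x)) :=
          add_le_add (hup k x) (redge k x)
      _ = ENNReal.ofReal (4 * (D0 * R ^ k) + d (r k x) (r (k + 1) x)) :=
          (ENNReal.ofReal_add (by have := hΔ k; positivity) (hdn _ _)).symm
      _ ≤ _ := ENNReal.ofReal_le_ofReal (by linarith)
  refine ⟨T, hdom, ?_⟩
  intro x y k m hd hm1 hm2
  have hΔk := hΔ k
  have hΔk1 := hΔ (k + 1)
  have hΔs : D0 * (R : ℝ) ^ (k + 1) = R * (D0 * R ^ k) := by rw [pow_succ]; ring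
  have h3R : 3 / (R : ℝ) ≤ 3 / 4 := by
    rw [div_le_div_iff₀ hRpos (by norm_num)]; linarith
  have hfg : ⌊u (k + 1) (g x y)⌋ = m := by
    rw [Int.floor_eq_iff]; constructor <;> linarith
  have hquart : ∀ a, g x y ≤ a → a ≤ g x y + d x y → ⌊u (k + 1) a⌋ = m := by
    intro a ha1 ha2
    rw [Int.floor_eq_iff]
    refine ⟨hm1.trans (umono _ _ _ ha1), ?_⟩
    have h1 := usub (k + 1) a (g x y)
    have h2 : u (k + 1) a - u (k + 1) (g x y) ≤ 1 / 4 := by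
      by_contra hcon
      push Not at hcon
      have := mul_lt_mul_of_pos_right hcon hΔk1
      linarith
    linarith
  have hfx := hquart (dep x) (hgle x y) (hgd x y)
  have hfy := hquart (dep y) (by rw [hgc]; exact hgle y x) (by rw [hgc, hcomm]; exact hgd y x)
  have hExy : E (k + 1) x y := ⟨by rw [hfx, hfy], by rw [hfx, hfg]⟩
  have hw : r (k + 1) y = r (k + 1) x := (rb _ _ _ hExy).symm
  have hx2 := hup2 k x
  have hy2 := hup2 k y
  have hExw := ra (k + 1) x
  have hEyw := ra (k + 1) y
  rw [hw] at hy2 hEyw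
  obtain ⟨m1, hm1', hm1''⟩ := rmin k x x ((hE _).refl x)
  obtain ⟨m2, hm2', hm2''⟩ := rmin k x y hExy
  generalize r (k + 1) x = w at *
  have hwx := hdepd k _ _ ((hE k).symm hm1'')
  have hwy := hdepd k _ _ ((hE k).symm hm2'')
  have hL : ∀ a, m ≤ ⌊u (k + 1) a⌋ → g x y - 3 * (D0 * R ^ k) ≤ a := by
    intro a ha
    have h1 := usub (k + 1) (g x y) a
    have h2 : (m : ℝ) ≤ u (k + 1) a := Int.le_floor.1 ha
    have h3 : (u (k + 1) (g x y) - u (k + 1) a) * (D0 * R ^ (k + 1)) ≤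
        3 / R * (D0 * R ^ (k + 1)) :=
      mul_le_mul_of_nonneg_right (by linarith) hΔk1.le
    have h4 : 3 / (R : ℝ) * (D0 * R ^ (k + 1)) = 3 * (D0 * R ^ k) := by
      rw [hΔs]; field_simp
    linarith
  have hgxw := hL (g x w) (by rw [← hfx]; exact hExw.2)
  have hgyw := hL (g y w) (by rw [← hfy]; exact hEyw.2)
  have e1 := hg x w
  have e2 := hg y w
  have e3 := hg x y
  calc T.dist x y ≤ T.dist x w + T.dist w y := dist_triangle T _ _ _
    _ = T.dist x w + T.dist y w := by rw [dist_comm T w y]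
    _ ≤ _ := add_le_add hx2 hy2
    _ = ENNReal.ofReal ((6 * (D0 * R ^ k) + d x w) + (6 * (D0 * R ^ k) + d y w)) :=
        (ENNReal.ofReal_add (by have := hdn x w; positivity)
          (by have := hdn y w; positivity)).symm
    _ ≤ _ := ENNReal.ofReal_le_ofReal (by linarith)

end TC

/-- There is an absolute constant `C > 0` such that for every
`ε ∈ (0,1)`, every weighted (finite) tree `T` and every nonempty set of terminals
`K ⊆ V(T)`, there is a non-Steiner tree cover of `(K, d_T)` of size at most
`C·ε⁻²·log(2/ε)` and stretch `2 + ε`. -/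
theorem nonSteiner_tree_cover_stretch_two_plus_eps :
    ∃ C : ℝ, 0 < C ∧
      ∀ (ε : ℝ), ε ∈ Set.Ioo (0 : ℝ) 1 →
      ∀ (V : Type) (_ : Fintype V) (T : WeightedTree V) (K : Set V), K.Nonempty →
      ∃ Ts : List (WeightedTree ↥K),
        (Ts.length : ℝ) ≤ C * ε⁻¹ ^ 2 * Real.log (2 / ε) ∧
        IsNonSteinerTreeCover (fun x y : ↥K => (T.dist x.1 y.1).toReal) (2 + ε) Ts := by
  have hlog2 : 0 < Real.log 2 := Real.log_pos (by norm_num)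
  refine ⟨416 ^ 2 / Real.log 2, by positivity, ?_⟩
  rintro ε ⟨hε0, hε1⟩ V _ T K ⟨ρ, hρ⟩
  classical
  have : Nonempty ↥K := ⟨⟨ρ, hρ⟩⟩
  -- choice of the ratio `R = 2 ^ c`
  have h208 : 1 ≤ 208 / ε := by rw [le_div_iff₀ hε0]; linarith
  obtain ⟨c0, hc1, hc2⟩ := exists_nat_pow_near h208 (by norm_num : (1 : ℝ) < 2)
  obtain ⟨c, hc⟩ : ∃ c, c = c0 + 1 := ⟨_, rfl⟩
  rw [← hc] at hc2
  obtain ⟨R, hRdef⟩ : ∃ R : ℕ, R = 2 ^ c := ⟨_, rfl⟩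
  have hRr : (R : ℝ) = 2 ^ c := by rw [hRdef]; push_cast; rfl
  have hRlow : 208 / ε < R := by rw [hRr]; exact hc2
  have hRup : (R : ℝ) ≤ 416 / ε := by
    rw [hRr, hc, pow_succ]
    calc (2 : ℝ) ^ c0 * 2 ≤ 208 / ε * 2 := by gcongr
      _ = 416 / ε := by ring
  have hR208 : (208 : ℝ) < R := by
    refine lt_of_le_of_lt ?_ hRlow
    rw [le_div_iff₀ hε0]; nlinarith
  have hR4 : 4 ≤ R := by
    have : (4 : ℝ) ≤ R := by linarith
    exact_mod_cast this
  have hcR : c ≤ R := by rw [hRdef]; exact Nat.lt_two_pow_self.le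
  have hRpos : (0 : ℝ) < R := by linarith
  -- the metric on K
  let d : ↥K → ↥K → ℝ := fun x y => TC.rd T x.1 y.1
  have hself : ∀ x, d x x = 0 := fun x => TC.rd_self T _
  have hcomm : ∀ x y, d x y = d y x := fun x y => TC.rd_comm T _ _
  have hpos : ∀ x y, x ≠ y → 0 < d x y := fun x y h =>
    TC.rd_pos T (fun h' => h (Subtype.ext h'))
  have htri : ∀ x y z, d x z ≤ d x y + d y z := fun x y z => TC.rd_triangle T _ _ _
  let dep : ↥K → ℝ := fun x => TC.rd T ρ x.1
  let g : ↥K → ↥K → ℝ := fun x y => (dep x + dep y - d x y) / 2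
  have hg : ∀ x y, d x y = dep x + dep y - 2 * g x y := fun x y => by simp only [g]; ring
  have hg0 : ∀ x y, 0 ≤ g x y := fun x y => by
    have h1 := TC.rd_triangle T x.1 ρ y.1
    have h2 := TC.rd_comm T x.1 ρ
    simp only [g, dep, d]; linarith
  have hdep : ∀ x y, dep x ≤ dep y + d x y := fun x y => by
    have h1 := TC.rd_triangle T ρ y.1 x.1
    have h2 := TC.rd_comm T y.1 x.1
    simp only [dep, d]; linarith
  have hyp : ∀ x y z, min (g x y) (g y z) ≤ g x z := fun x y z => by
    have h1 := TC.four_point T x.1 y.1 z.1 ρ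
    rw [min_le_iff]
    simp only [g, dep, d]
    rcases le_max_iff.1 h1 with h | h
    · left; linarith
    · right; linarith
  -- minimal distance
  obtain ⟨δ, hδ0, hδ⟩ : ∃ δ : ℝ, 0 < δ ∧ ∀ x y, x ≠ y → δ * R ≤ d x y := by
    obtain ⟨p, hp⟩ := Finite.exists_min
      (fun p : ↥K × ↥K => if p.1 = p.2 then 1 + ∑ x, ∑ y, d x y else d p.1 p.2)
    have hnn : ∀ x y, 0 ≤ d x y := fun x y => ENNReal.toReal_nonneg
    refine ⟨(if p.1 = p.2 then 1 + ∑ x, ∑ y, d x y else d p.1 p.2) / R, ?_, ?_⟩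
    · refine div_pos ?_ hRpos
      split_ifs with h
      · have : 0 ≤ ∑ x, ∑ y, d x y :=
          Finset.sum_nonneg fun x _ => Finset.sum_nonneg fun y _ => hnn x y
        linarith
      · exact hpos _ _ h
    · intro x y hxy
      rw [div_mul_cancel₀ _ hRpos.ne']
      have := hp (x, y)
      simpa only [hxy, if_false] using this
  have htree : ∀ p : Fin c × Fin (R - 1), ∃ T' : WeightedTree ↥K,
      (∀ x y, ENNReal.ofReal (d x y) ≤ T'.dist x y) ∧
      ∀ x y k (m : ℤ), 4 * d x y ≤ δ * 2 ^ (p.1 : ℕ) * R ^ (k + 1) →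
        (m : ℝ) ≤ TC.uu (δ * 2 ^ (p.1 : ℕ)) R p.2 (k + 1) (g x y) →
        TC.uu (δ * 2 ^ (p.1 : ℕ)) R p.2 (k + 1) (g x y) < m + 3 / R →
        T'.dist x y ≤ ENNReal.ofReal (2 * d x y + 26 * (δ * 2 ^ (p.1 : ℕ) * R ^ k)) := by
    rintro ⟨j, s⟩
    refine TC.shift_tree d hself hcomm hpos htri dep g hg hg0 hdep hyp (δ * 2 ^ (j : ℕ))
      (by positivity) ?_ R s hR4 (by have := s.2; omega)
    intro x y hxy
    refine le_trans ?_ (hδ x y hxy)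
    rw [hRr]
    calc 2 * (δ * 2 ^ (j : ℕ)) = δ * 2 ^ ((j : ℕ) + 1) := by rw [pow_succ]; ring
      _ ≤ δ * 2 ^ c := by
        gcongr
        · norm_num
        · have := j.2; omega
  choose TT hTdom hTst using htree
  refine ⟨(Finset.univ : Finset (Fin c × Fin (R - 1))).toList.map TT, ?_, ?_, ?_⟩
  · rw [List.length_map, Finset.length_toList, Finset.card_univ, Fintype.card_prod, Fintype.card_fin,
      Fintype.card_fin]
    have h1 : c * (R - 1) ≤ R * R := Nat.mul_le_mul hcR (by omega)
    have h2 : ((c * (R - 1) : ℕ) : ℝ) ≤ R * R := by exact_mod_cast h1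
    have h3 : (R : ℝ) * R ≤ 416 / ε * (416 / ε) := by gcongr
    have h4 : Real.log 2 ≤ Real.log (2 / ε) := by
      apply Real.log_le_log (by norm_num)
      rw [le_div_iff₀ hε0]; linarith
    have h5 : 416 / ε * (416 / ε) = 416 ^ 2 / Real.log 2 * ε⁻¹ ^ 2 * Real.log 2 := by
      field_simp
    calc _ ≤ _ := h2
      _ ≤ _ := h3
      _ = _ := h5
      _ ≤ _ := by gcongr
  · intro T' hT'
    rw [List.mem_map] at hT'
    obtain ⟨p, -, rfl⟩ := hT'
    exact hTdom p
  · intro x y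
    simp only [List.mem_map, Finset.mem_toList, Finset.mem_univ, true_and, exists_exists_eq_and]
    change ∃ p, (TT p).dist x y ≤ ENNReal.ofReal ((2 + ε) * d x y)
    by_cases hxy : x = y
    · subst hxy
      refine ⟨(⟨0, by omega⟩, ⟨0, by omega⟩), ?_⟩
      rw [TC.dist_self]; exact bot_le
    have hd0 := hpos x y hxy
    have hδd := hδ x y hxy
    have h4d : (R : ℝ) ≤ 4 * d x y / δ := by rw [le_div_iff₀ hδ0]; linarith
    obtain ⟨n, hn1, hn2⟩ := exists_nat_pow_near (by linarith : 1 ≤ 4 * d x y / δ)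
      (by norm_num : (1 : ℝ) < 2)
    obtain ⟨i, hi⟩ : ∃ i, i = n + 1 := ⟨_, rfl⟩
    rw [← hi] at hn2
    rw [div_lt_iff₀ hδ0] at hn2
    rw [le_div_iff₀ hδ0] at hn1
    have hi8 : δ * 2 ^ i ≤ 8 * d x y := by rw [hi, pow_succ]; linarith
    have hic : c ≤ i := by
      have h1 : (2 : ℝ) ^ c ≤ 2 ^ i := by
        rw [← hRr]
        by_contra hcon
        push Not at hcon
        have := mul_lt_mul_of_pos_right hcon hδ0
        linarith
      exact (pow_le_pow_iff_right₀ (by norm_num : (1 : ℝ) < 2)).1 h1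
    have hc0 : 0 < c := by omega
    obtain ⟨k, hk⟩ : ∃ k, i / c = k + 1 :=
      ⟨i / c - 1, by have := Nat.div_pos hic hc0; omega⟩
    have hdecomp : δ * 2 ^ (i % c) * (R : ℝ) ^ (k + 1) = δ * 2 ^ i := by
      rw [hRr, ← pow_mul, mul_assoc, ← pow_add, ← hk, Nat.mod_add_div]
    obtain ⟨s, hs, m, hm1, hm2⟩ := TC.choose_shift R hR4 (δ * 2 ^ (i % c)) (by positivity) k (g x y)
    refine ⟨(⟨i % c, Nat.mod_lt _ hc0⟩, ⟨s, by omega⟩), ?_⟩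
    refine (hTst _ x y k m ?_ hm1 hm2).trans (ENNReal.ofReal_le_ofReal ?_)
    · change 4 * d x y ≤ δ * 2 ^ (i % c) * (R : ℝ) ^ (k + 1)
      rw [hdecomp]; linarith
    · change 2 * d x y + 26 * (δ * 2 ^ (i % c) * (R : ℝ) ^ k) ≤ (2 + ε) * d x y
      have h1 : δ * 2 ^ (i % c) * (R : ℝ) ^ k * R ≤ 8 * d x y := by
        rw [mul_assoc, ← pow_succ, hdecomp]; exact hi8
      have h2 : 208 < R * ε := by rwa [div_lt_iff₀ hε0] at hRlow
      have h3 : 26 * (δ * 2 ^ (i % c) * (R : ℝ) ^ k) ≤ ε * d x y := by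
        refine le_of_mul_le_mul_right ?_ hRpos
        have : 208 * d x y ≤ R * ε * d x y := by gcongr
        linarith
      linarith
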